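/- Let N, m ≥ 1, let Φ and Ψ satisfy condition (K), and let p₁, q₁, p₂, q₂ > 0 satisfy either (p₁ + q₁ ≥ 2 and p₂ + q₂ ≥ 2) or (p₁ ≥ 1 and p₂ ≥ 1). Let (u, v) be a pair of non-negative functions u, v ∈ C^{2m}(ℝ^N) with ∫_{|y|>1} v(y)^{p₁} Φ(|y|/2) dy < ∞ and ∫_{|y|>1} u(y)^{p₂} Ψ(|y|/2) dy < ∞, satisfying pointwise in ℝ^N the system (−Δ)^m u ≥ (Φ(|·|) * v^{p₁}) v^{q₁} and (−Δ)^m v ≥ (Ψ(|·|) * u^{p₂}) u^{q₂}. Then for all 1 ≤ i ≤ m one has (−Δ)^i u ≥ 0 and (−Δ)^i v ≥ 0 pointwise in ℝ^N. -/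

import Mathlib

open MeasureTheory Filter Metric

/-- The Laplacian of `u : ℝ^N → ℝ`, defined via the second iterated Fréchet derivative. -/
noncomputable def lap {N : ℕ} (u : EuclideanSpace ℝ (Fin N) → ℝ) :
    EuclideanSpace ℝ (Fin N) → ℝ :=
  fun x => ∑ i : Fin N,
    iteratedFDeriv ℝ 2 u x ![EuclideanSpace.single i 1, EuclideanSpace.single i 1]

/-- `negLapPow m u = (-Δ)^m u`, the `m`-fold iterate of the negative Laplacian. -/
noncomputable def negLapPow {N : ℕ} (m : ℕ) (u : EuclideanSpace ℝ (Fin N) → ℝ) :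
    EuclideanSpace ℝ (Fin N) → ℝ :=
  (fun v => fun x => -(lap v x))^[m] u

/-- Condition (K) on the kernel `Ψ`. -/
structure CondK (N : ℕ) (Ψ : ℝ → ℝ) : Prop where
  pos : ∀ r : ℝ, 0 < r → 0 < Ψ r
  cont : ContinuousOn (fun x : EuclideanSpace ℝ (Fin N) => Ψ ‖x‖)
    {(0 : EuclideanSpace ℝ (Fin N))}ᶜ
  locInt : LocallyIntegrable (fun x : EuclideanSpace ℝ (Fin N) => Ψ ‖x‖) volume
  anti : AntitoneOn Ψ (Set.Ioi (0 : ℝ))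
  tendsto : Tendsto (fun r : ℝ => r ^ N * Ψ r) atTop atTop

/-- The kernel `z ↦ (1 - ‖z‖²)₊ ^ k`. -/
noncomputable def bumpPow {N : ℕ} (k : ℕ) (z : EuclideanSpace ℝ (Fin N)) : ℝ :=
  max (1 - ‖z‖ ^ 2) 0 ^ k

/-- The integral of `w` over the ball of radius `r` around `x₀`, rescaled to the unit ball and
weighted with `bumpPow k`. -/
noncomputable def wavg {N : ℕ} (k : ℕ) (w : EuclideanSpace ℝ (Fin N) → ℝ)
    (x₀ : EuclideanSpace ℝ (Fin N)) (r : ℝ) : ℝ :=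
  ∫ z, w (x₀ + r • z) * bumpPow k z

section Bump

variable {N : ℕ}

lemma bumpPow_nonneg (k : ℕ) (z : EuclideanSpace ℝ (Fin N)) : 0 ≤ bumpPow k z :=
  pow_nonneg (le_max_right _ _) _

lemma bumpPow_le_one (k : ℕ) (z : EuclideanSpace ℝ (Fin N)) : bumpPow k z ≤ 1 :=
  pow_le_one₀ (le_max_right _ _) (max_le (by nlinarith [sq_nonneg ‖z‖]) zero_le_one)

lemma bumpPow_antitone {k l : ℕ} (h : k ≤ l) (z : EuclideanSpace ℝ (Fin N)) :
    bumpPow l z ≤ bumpPow k z :=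
  pow_le_pow_of_le_one (le_max_right _ _)
    (max_le (by nlinarith [sq_nonneg ‖z‖]) zero_le_one) h

lemma bumpPow_eq_zero (k : ℕ) {z : EuclideanSpace ℝ (Fin N)} (h : 1 ≤ ‖z‖) :
    bumpPow (k + 1) z = 0 := by
  have : (1 - ‖z‖ ^ 2) ≤ 0 := by nlinarith
  simp [bumpPow, max_eq_right this]

lemma continuous_bumpPow (k : ℕ) :
    Continuous (bumpPow k : EuclideanSpace ℝ (Fin N) → ℝ) := by
  unfold bumpPow; fun_prop

lemma hasCompactSupport_bumpPow (k : ℕ) :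
    HasCompactSupport (bumpPow (k + 1) : EuclideanSpace ℝ (Fin N) → ℝ) := by
  refine HasCompactSupport.intro (isCompact_closedBall 0 1) fun z hz => bumpPow_eq_zero k ?_
  simp only [mem_closedBall, dist_zero_right, not_le] at hz
  exact hz.le

lemma normSq_mul_bumpPow (k : ℕ) (z : EuclideanSpace ℝ (Fin N)) :
    ‖z‖ ^ 2 * bumpPow (k + 1) z = bumpPow (k + 1) z - bumpPow (k + 2) z := by
  unfold bumpPow
  rcases le_total (1 - ‖z‖ ^ 2) 0 with h | h
  · simp [max_eq_right h]
  · rw [max_eq_left h]; ring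

lemma hasDerivAt_max_zero_pow (k : ℕ) (t : ℝ) :
    HasDerivAt (fun t : ℝ => max t 0 ^ (k + 2)) ((k + 2) * max t 0 ^ (k + 1)) t := by
  rcases lt_trichotomy t 0 with h | h | h
  · have : (fun t : ℝ => max t 0 ^ (k + 2)) =ᶠ[nhds t] fun _ => 0 := by
      filter_upwards [eventually_lt_nhds h] with s hs
      simp [max_eq_right hs.le]
    simpa [max_eq_right h.le] using (hasDerivAt_const t (0 : ℝ)).congr_of_eventuallyEq this
  · subst h
    have hO : (fun t : ℝ => max t 0 ^ (k + 2)) =o[nhds 0] fun t => t - 0 := by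
      have h1 : (fun t : ℝ => t ^ (k + 2)) =o[nhds 0] fun t : ℝ => t := by
        simpa using Asymptotics.isLittleO_pow_pow (𝕜 := ℝ) (show 1 < k + 2 by omega)
      refine Asymptotics.IsBigO.trans_isLittleO (Asymptotics.IsBigO.of_bound 1 ?_)
        (by simpa using h1)
      refine Eventually.of_forall fun s => ?_
      have h2 : |max s 0| ≤ |s| := by
        rw [abs_of_nonneg (le_max_right s 0)]
        exact max_le (le_abs_self _) (abs_nonneg _)
      rw [norm_pow, norm_pow, one_mul, Real.norm_eq_abs, Real.norm_eq_abs]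
      gcongr
    rw [hasDerivAt_iff_isLittleO]
    simpa using hO
  · have : (fun t : ℝ => max t 0 ^ (k + 2)) =ᶠ[nhds t] fun t => t ^ (k + 2) := by
      filter_upwards [eventually_gt_nhds h] with s hs
      simp [max_eq_left hs.le]
    simpa [max_eq_left h.le] using (hasDerivAt_pow (k + 2) t).congr_of_eventuallyEq this

lemma hasLineDerivAt_bumpPow (k : ℕ) (z : EuclideanSpace ℝ (Fin N)) (i : Fin N) :
    HasLineDerivAt ℝ (bumpPow (k + 2)) (-(2 * (k + 2)) * (z i * bumpPow (k + 1) z)) z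
      (EuclideanSpace.single i 1) := by
  have h1 : HasFDerivAt (fun z : EuclideanSpace ℝ (Fin N) => 1 - ‖z‖ ^ 2)
      (-(2 • innerSL ℝ z)) z := by
    simpa using (hasStrictFDerivAt_norm_sq z).hasFDerivAt.const_sub 1
  have h2 := ((hasDerivAt_max_zero_pow k (1 - ‖z‖ ^ 2)).comp_hasFDerivAt z h1).hasLineDerivAt
    (EuclideanSpace.single i 1)
  convert! h2 using 1
  simp [bumpPow, EuclideanSpace.inner_single_right]
  ring

lemma hasLineDerivAt_coord (z : EuclideanSpace ℝ (Fin N)) (i : Fin N) :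
    HasLineDerivAt ℝ (fun z : EuclideanSpace ℝ (Fin N) => z i) 1 z
      (EuclideanSpace.single i 1) := by
  have := ((EuclideanSpace.proj i : EuclideanSpace ℝ (Fin N) →L[ℝ] ℝ).hasFDerivAt
    (x := z)).hasLineDerivAt (EuclideanSpace.single i 1)
  simpa using! this

lemma integral_mul_lineDeriv_eq_neg {f f' h h' : EuclideanSpace ℝ (Fin N) → ℝ}
    {e : EuclideanSpace ℝ (Fin N)}
    (hf : ∀ z, HasLineDerivAt ℝ f (f' z) z e) (hh : ∀ z, HasLineDerivAt ℝ h (h' z) z e)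
    (cf : Continuous f) (cf' : Continuous f') (ch : Continuous h) (ch' : Continuous h')
    (sh : HasCompactSupport h) (sh' : HasCompactSupport h') :
    ∫ z, f z * h' z = -∫ z, f' z * h z :=
  integral_bilinear_hasLineDerivAt_right_eq_neg_left_of_integrable
    (B := ContinuousLinearMap.mul ℝ ℝ)
    ((cf'.mul ch).integrable_of_hasCompactSupport sh.mul_left)
    ((cf.mul ch').integrable_of_hasCompactSupport sh'.mul_left)
    ((cf.mul ch).integrable_of_hasCompactSupport sh.mul_left) (fun z _ => hf z) fun z _ => hh z

lemma integrable_wavg (k : ℕ) {w : EuclideanSpace ℝ (Fin N) → ℝ} (hw : Continuous w)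
    (x₀ : EuclideanSpace ℝ (Fin N)) (r : ℝ) :
    Integrable fun z => w (x₀ + r • z) * bumpPow (k + 1) z :=
  Continuous.integrable_of_hasCompactSupport
    ((hw.comp (by fun_prop)).mul (continuous_bumpPow _))
    (hasCompactSupport_bumpPow k).mul_left

lemma hasLineDerivAt_comp_affine {w : EuclideanSpace ℝ (Fin N) → ℝ} (hw : Differentiable ℝ w)
    (x₀ : EuclideanSpace ℝ (Fin N)) (r : ℝ) (z e : EuclideanSpace ℝ (Fin N)) :
    HasLineDerivAt ℝ (fun z => w (x₀ + r • z)) (r * fderiv ℝ w (x₀ + r • z) e) z e := by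
  have h1 : HasFDerivAt (fun z : EuclideanSpace ℝ (Fin N) => x₀ + r • z)
      (r • ContinuousLinearMap.id ℝ _) z := ((hasFDerivAt_id z).const_smul r).const_add x₀
  have := ((hw (x₀ + r • z)).hasFDerivAt.comp z h1).hasLineDerivAt e
  simpa using! this

lemma fderiv_apply_eq_sum (w : EuclideanSpace ℝ (Fin N) → ℝ) (x z : EuclideanSpace ℝ (Fin N)) :
    fderiv ℝ w x z = ∑ i, fderiv ℝ w x (EuclideanSpace.single i 1) * z i := by
  conv_lhs => rw [← (EuclideanSpace.basisFun (Fin N) ℝ).sum_repr z]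
  simp [map_sum, mul_comm]

lemma lap_eq_sum (w : EuclideanSpace ℝ (Fin N) → ℝ) (x : EuclideanSpace ℝ (Fin N)) :
    lap w x = ∑ i, fderiv ℝ (fderiv ℝ w) x (EuclideanSpace.single i 1)
      (EuclideanSpace.single i 1) := by
  simp [lap, iteratedFDeriv_two_apply]

lemma ContDiff.lap {n : WithTop ℕ∞} {w : EuclideanSpace ℝ (Fin N) → ℝ} (hw : ContDiff ℝ (n + 2) w) :
    ContDiff ℝ n (lap w) := by
  have h : ContDiff ℝ n (iteratedFDeriv ℝ 2 w) := hw.iteratedFDeriv_right le_rfl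
  unfold _root_.lap
  refine ContDiff.sum fun i _ => ?_
  exact (ContinuousMultilinearMap.apply ℝ (fun _ : Fin 2 => EuclideanSpace ℝ (Fin N)) ℝ
    ![EuclideanSpace.single i 1, EuclideanSpace.single i 1]).contDiff.comp h

lemma integral_fderiv_mul_bumpPow_eq_sum (k : ℕ) {w : EuclideanSpace ℝ (Fin N) → ℝ}
    (hw : ContDiff ℝ 1 w) (x₀ : EuclideanSpace ℝ (Fin N)) (r : ℝ) :
    ∫ z, fderiv ℝ w (x₀ + r • z) z * bumpPow (k + 1) z =
      ∑ i, ∫ z, fderiv ℝ w (x₀ + r • z) (EuclideanSpace.single i 1) *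
        (z i * bumpPow (k + 1) z) := by
  have hc : Continuous (fderiv ℝ w) := hw.continuous_fderiv one_ne_zero
  rw [← integral_finsetSum]
  · refine integral_congr_ae (Eventually.of_forall fun z => ?_)
    simp only [fderiv_apply_eq_sum w _ z, Finset.sum_mul, mul_assoc]
  · intro i _
    refine Continuous.integrable_of_hasCompactSupport ?_
      ((hasCompactSupport_bumpPow k).mul_left.mul_left)
    have := continuous_bumpPow (N := N) (k + 1)
    fun_prop

lemma integral_fderiv_mul_bumpPow_eq_lap (k : ℕ) {w : EuclideanSpace ℝ (Fin N) → ℝ}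
    (hw : ContDiff ℝ 2 w) (x₀ : EuclideanSpace ℝ (Fin N)) (r : ℝ) :
    ∫ z, fderiv ℝ w (x₀ + r • z) z * bumpPow (k + 1) z =
      r / (2 * (k + 2)) * wavg (k + 2) (lap w) x₀ r := by
  have hc1 : ContDiff ℝ 1 (fderiv ℝ w) := hw.fderiv_right (by norm_num)
  have hc2 : Continuous (fderiv ℝ (fderiv ℝ w)) := hc1.continuous_fderiv one_ne_zero
  have hc := hc1.continuous
  have cb := continuous_bumpPow (N := N) (k + 1)
  have sb := hasCompactSupport_bumpPow (N := N) k
  rw [integral_fderiv_mul_bumpPow_eq_sum k (hw.of_le (by norm_num))]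
  have key : ∀ i : Fin N, ∫ z, fderiv ℝ w (x₀ + r • z) (EuclideanSpace.single i 1) *
        (z i * bumpPow (k + 1) z) = r / (2 * (k + 2)) *
        ∫ z, fderiv ℝ (fderiv ℝ w) (x₀ + r • z) (EuclideanSpace.single i 1)
          (EuclideanSpace.single i 1) * bumpPow (k + 2) z := by
    intro i
    have hd : Differentiable ℝ fun x => fderiv ℝ w x (EuclideanSpace.single i 1) :=
      (hc1.clm_apply contDiff_const).differentiable one_ne_zero
    have h1 : ∀ z, HasLineDerivAt ℝ
        (fun z => fderiv ℝ w (x₀ + r • z) (EuclideanSpace.single i 1))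
        (r * fderiv ℝ (fderiv ℝ w) (x₀ + r • z) (EuclideanSpace.single i 1)
          (EuclideanSpace.single i 1)) z (EuclideanSpace.single i 1) := by
      intro z
      have := hasLineDerivAt_comp_affine hd x₀ r z (EuclideanSpace.single i 1)
      rw [fderiv_clm_apply (hc1.differentiable one_ne_zero _) (by fun_prop)] at this
      simpa using! this
    have := integral_mul_lineDeriv_eq_neg h1 (fun z => hasLineDerivAt_bumpPow k z i)
      (by fun_prop) (by fun_prop) (continuous_bumpPow _) (by fun_prop)
      (hasCompactSupport_bumpPow (k + 1)) sb.mul_left.mul_left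
    have h2 : (2 * ((k : ℝ) + 2)) ≠ 0 := by positivity
    simp only [mul_left_comm _ (-(2 * ((k : ℝ) + 2))), mul_assoc r] at this
    rw [integral_const_mul, integral_const_mul] at this
    rw [div_mul_eq_mul_div, eq_div_iff h2]
    linarith
  simp only [key, ← Finset.mul_sum, wavg, lap_eq_sum, Finset.sum_mul]
  rw [integral_finsetSum]
  intro i _
  refine Continuous.integrable_of_hasCompactSupport ?_
      ((hasCompactSupport_bumpPow (k + 1)).mul_left)
  have := continuous_bumpPow (N := N) (k + 2)
  fun_prop

lemma mul_integral_fderiv_mul_bumpPow (k : ℕ) {w : EuclideanSpace ℝ (Fin N) → ℝ}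
    (hw : ContDiff ℝ 1 w) (x₀ : EuclideanSpace ℝ (Fin N)) (r : ℝ) :
    r * ∫ z, fderiv ℝ w (x₀ + r • z) z * bumpPow (k + 2) z =
      2 * (k + 2) * wavg (k + 1) w x₀ r - (N + 2 * (k + 2)) * wavg (k + 2) w x₀ r := by
  have hc : Continuous (fderiv ℝ w) := hw.continuous_fderiv one_ne_zero
  have hwc := hw.continuous
  have cb := continuous_bumpPow (N := N) (k + 1)
  have cb2 := continuous_bumpPow (N := N) (k + 2)
  have sb := hasCompactSupport_bumpPow (N := N) k
  have sb2 := hasCompactSupport_bumpPow (N := N) (k + 1)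
  have key : ∀ i : Fin N, r * ∫ z, fderiv ℝ w (x₀ + r • z) (EuclideanSpace.single i 1) *
        (z i * bumpPow (k + 2) z) =
        ∫ z, w (x₀ + r • z) * (2 * (k + 2) * (z i ^ 2 * bumpPow (k + 1) z)
          - bumpPow (k + 2) z) := by
    intro i
    have h1 : ∀ z : EuclideanSpace ℝ (Fin N), HasLineDerivAt ℝ (fun z : EuclideanSpace ℝ (Fin N) =>
        z i * bumpPow (k + 2) z)
        (-(2 * (k + 2) * (z i ^ 2 * bumpPow (k + 1) z) - bumpPow (k + 2) z)) z
        (EuclideanSpace.single i 1) := by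
      intro z
      have := HasDerivAt.mul (hasLineDerivAt_coord z i) (hasLineDerivAt_bumpPow k z i)
      unfold HasLineDerivAt
      convert! this using 1
      simp
      ring
    have := integral_mul_lineDeriv_eq_neg
      (fun z => hasLineDerivAt_comp_affine (hw.differentiable one_ne_zero) x₀ r z
        (EuclideanSpace.single i 1)) h1
      (by fun_prop) (by fun_prop) (by fun_prop) (by fun_prop)
      sb2.mul_left (((sb.mul_left).mul_left).sub sb2).neg
    simp only [mul_neg, integral_neg, mul_assoc r] at this
    rw [integral_const_mul] at this
    simpa using! (neg_inj.1 this).symm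
  rw [integral_fderiv_mul_bumpPow_eq_sum (k + 1) hw, Finset.mul_sum]
  simp only [key]
  rw [← integral_finsetSum]
  · simp only [wavg]
    rw [← integral_const_mul, ← integral_const_mul, ← integral_sub]
    · refine integral_congr_ae (Eventually.of_forall fun z => ?_)
      have h3 := normSq_mul_bumpPow k z
      rw [EuclideanSpace.real_norm_sq_eq] at h3
      simp only [← Finset.mul_sum, Finset.sum_sub_distrib, ← Finset.sum_mul, h3]
      simp
      ring
    · exact (integrable_wavg k hwc x₀ r).const_mul _
    · exact (integrable_wavg (k + 1) hwc x₀ r).const_mul _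
  · intro i _
    refine Continuous.integrable_of_hasCompactSupport (by fun_prop) ?_
    exact (((sb.mul_left).mul_left).sub sb2).mul_left

lemma hasDerivAt_wavg_fderiv (k : ℕ) {w : EuclideanSpace ℝ (Fin N) → ℝ}
    (hw : ContDiff ℝ 1 w) (x₀ : EuclideanSpace ℝ (Fin N)) (r : ℝ) :
    HasDerivAt (wavg (k + 1) w x₀)
      (∫ z, fderiv ℝ w (x₀ + r • z) z * bumpPow (k + 1) z) r := by
  have hc : Continuous (fderiv ℝ w) := hw.continuous_fderiv one_ne_zero
  have hwc := hw.continuous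
  have cb := continuous_bumpPow (N := N) (k + 1)
  have sb := hasCompactSupport_bumpPow (N := N) k
  obtain ⟨C, hC⟩ := (isCompact_closedBall x₀ (|r| + 1)).exists_bound_of_continuousOn
    hc.continuousOn
  refine (hasDerivAt_integral_of_dominated_loc_of_deriv_le
    (F := fun s z => w (x₀ + s • z) * bumpPow (k + 1) z)
    (F' := fun s z => fderiv ℝ w (x₀ + s • z) z * bumpPow (k + 1) z)
    (bound := fun z => C * bumpPow (k + 1) z)
    (ball_mem_nhds r one_pos) ?_ (integrable_wavg k hwc x₀ r) ?_ ?_ ?_ ?_).2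
  · exact Eventually.of_forall fun s => (integrable_wavg k hwc x₀ s).aestronglyMeasurable
  · exact Continuous.aestronglyMeasurable (by fun_prop)
  · refine Eventually.of_forall fun z s hs => ?_
    rw [norm_mul, Real.norm_of_nonneg (bumpPow_nonneg (k + 1) z)]
    rcases le_total 1 ‖z‖ with h | h
    · simp [bumpPow_eq_zero k h]
    · refine mul_le_mul_of_nonneg_right ?_ (bumpPow_nonneg _ _)
      have hs' : |s| ≤ |r| + 1 := by
        rw [mem_ball, Real.dist_eq] at hs
        have := abs_sub_abs_le_abs_sub s r
        linarith
      have hmem : x₀ + s • z ∈ closedBall x₀ (|r| + 1) := by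
        rw [mem_closedBall, dist_self_add_left, norm_smul, Real.norm_eq_abs]
        nlinarith [norm_nonneg z, abs_nonneg s]
      calc ‖fderiv ℝ w (x₀ + s • z) z‖ ≤ ‖fderiv ℝ w (x₀ + s • z)‖ * ‖z‖ :=
            ContinuousLinearMap.le_opNorm _ _
        _ ≤ ‖fderiv ℝ w (x₀ + s • z)‖ * 1 := by gcongr
        _ ≤ C := by rw [mul_one]; exact hC _ hmem
  · exact (cb.integrable_of_hasCompactSupport sb).const_mul C
  · refine Eventually.of_forall fun z s _ => HasDerivAt.mul_const ?_ _
    have h1 : HasDerivAt (fun s : ℝ => x₀ + s • z) z s := by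
      simpa using ((hasDerivAt_id s).smul_const z).const_add x₀
    exact ((hw.differentiable one_ne_zero _).hasFDerivAt).comp_hasDerivAt s h1

lemma hasDerivAt_wavg (k : ℕ) {w : EuclideanSpace ℝ (Fin N) → ℝ}
    (hw : ContDiff ℝ 2 w) (x₀ : EuclideanSpace ℝ (Fin N)) (r : ℝ) :
    HasDerivAt (wavg (k + 1) w x₀) (r / (2 * (k + 2)) * wavg (k + 2) (lap w) x₀ r) r := by
  rw [← integral_fderiv_mul_bumpPow_eq_lap k hw x₀ r]
  exact hasDerivAt_wavg_fderiv k (hw.of_le (by norm_num)) x₀ r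

lemma sq_mul_wavg_lap (k : ℕ) {w : EuclideanSpace ℝ (Fin N) → ℝ}
    (hw : ContDiff ℝ 2 w) (x₀ : EuclideanSpace ℝ (Fin N)) (r : ℝ) :
    r ^ 2 * wavg (k + 3) (lap w) x₀ r =
      2 * (k + 3) * (2 * (k + 2) * wavg (k + 1) w x₀ r
        - (N + 2 * (k + 2)) * wavg (k + 2) w x₀ r) := by
  rw [← mul_integral_fderiv_mul_bumpPow k (hw.of_le (by norm_num)),
    integral_fderiv_mul_bumpPow_eq_lap (k + 1) hw]
  push_cast
  field_simp
  ring_nf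

end Bump

section Growth

variable {N : ℕ}

lemma negLapPow_zero (w : EuclideanSpace ℝ (Fin N) → ℝ) : negLapPow 0 w = w := rfl

lemma negLapPow_succ (i : ℕ) (w : EuclideanSpace ℝ (Fin N) → ℝ) :
    negLapPow (i + 1) w = fun x => -(lap (negLapPow i w) x) := by
  simp only [negLapPow, Function.iterate_succ_apply']

lemma contDiff_negLapPow (i n : ℕ) {w : EuclideanSpace ℝ (Fin N) → ℝ}
    (hw : ContDiff ℝ (2 * ((n + i : ℕ) : WithTop ℕ∞)) w) :
    ContDiff ℝ (2 * (n : WithTop ℕ∞)) (negLapPow i w) := by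
  induction i generalizing n with
  | zero => exact hw
  | succ i ih =>
    have h : ContDiff ℝ (2 * (n : WithTop ℕ∞) + 2) (negLapPow i w) := by
      have := ih (n + 1) (by rwa [add_right_comm, add_assoc])
      convert! this using 1
    rw [negLapPow_succ]
    exact h.lap.neg

lemma contDiff_two_negLapPow {i m : ℕ} (him : i < m) {w : EuclideanSpace ℝ (Fin N) → ℝ}
    (hw : ContDiff ℝ (2 * (m : WithTop ℕ∞)) w) : ContDiff ℝ 2 (negLapPow i w) := by
  obtain ⟨n, rfl⟩ := Nat.exists_eq_add_of_lt him
  refine (contDiff_negLapPow i (n + 1) (by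
    rwa [show n + 1 + i = i + n + 1 by omega])).of_le ?_
  exact_mod_cast (by omega : 2 ≤ 2 * (n + 1))

lemma continuous_negLapPow {m : ℕ} {w : EuclideanSpace ℝ (Fin N) → ℝ}
    (hw : ContDiff ℝ (2 * (m : WithTop ℕ∞)) w) : Continuous (negLapPow m w) :=
  (contDiff_negLapPow m 0 (by simpa using hw)).continuous

lemma wavg_neg (k : ℕ) (w : EuclideanSpace ℝ (Fin N) → ℝ) (x₀ : EuclideanSpace ℝ (Fin N)) (r : ℝ) :
    wavg k (fun x => -(w x)) x₀ r = -wavg k w x₀ r := by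
  simp [wavg, integral_neg]

lemma wavg_mono (k : ℕ) {w w' : EuclideanSpace ℝ (Fin N) → ℝ} (hw : Continuous w)
    (hw' : Continuous w') (h : ∀ x, w x ≤ w' x) (x₀ : EuclideanSpace ℝ (Fin N)) (r : ℝ) :
    wavg (k + 1) w x₀ r ≤ wavg (k + 1) w' x₀ r :=
  integral_mono (integrable_wavg k hw x₀ r) (integrable_wavg k hw' x₀ r) fun _ =>
    mul_le_mul_of_nonneg_right (h _) (bumpPow_nonneg _ _)

lemma wavg_nonneg (k : ℕ) {w : EuclideanSpace ℝ (Fin N) → ℝ}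
    (h : ∀ x, 0 ≤ w x) (x₀ : EuclideanSpace ℝ (Fin N)) (r : ℝ) : 0 ≤ wavg k w x₀ r :=
  integral_nonneg fun _ => mul_nonneg (h _) (bumpPow_nonneg _ _)

lemma wavg_antitone {k l : ℕ} (hkl : k ≤ l) {w : EuclideanSpace ℝ (Fin N) → ℝ} (hw : Continuous w)
    (h : ∀ x, 0 ≤ w x) (x₀ : EuclideanSpace ℝ (Fin N)) (r : ℝ) :
    wavg (l + 1) w x₀ r ≤ wavg (k + 1) w x₀ r :=
  integral_mono (integrable_wavg l hw x₀ r) (integrable_wavg k hw x₀ r) fun z =>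
    mul_le_mul_of_nonneg_left (bumpPow_antitone (by omega) z) (h _)

lemma exists_pow_mul_abs_wavg_negLapPow_le {m : ℕ} {w : EuclideanSpace ℝ (Fin N) → ℝ}
    (hw : ContDiff ℝ (2 * (m : WithTop ℕ∞)) w) (hpos : ∀ x, 0 ≤ w x) (j : ℕ) (hj : j ≤ m) (k : ℕ) :
    ∃ C, 0 ≤ C ∧ ∀ x₀ r, r ^ (2 * j) * |wavg (k + 1 + 2 * j) (negLapPow j w) x₀ r| ≤
      C * wavg (k + 1) w x₀ r := by
  induction j generalizing k with
  | zero =>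
    refine ⟨1, zero_le_one, fun x₀ r => ?_⟩
    simp [negLapPow_zero, abs_of_nonneg (wavg_nonneg (k + 1) hpos x₀ r)]
  | succ j ih =>
    obtain ⟨C, hC0, hC⟩ := ih (by omega) k
    obtain ⟨C', hC0', hC'⟩ := ih (by omega) (k + 1)
    set a : ℝ := 2 * ((k + 2 * j : ℕ) + 3) * (2 * ((k + 2 * j : ℕ) + 2)) with ha
    set b : ℝ := 2 * ((k + 2 * j : ℕ) + 3) * (N + 2 * ((k + 2 * j : ℕ) + 2)) with hb
    have ha0 : 0 ≤ a := by positivity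
    have hb0 : 0 ≤ b := by positivity
    refine ⟨a * C + b * C', by positivity, fun x₀ r => ?_⟩
    have h2 := sq_mul_wavg_lap (k + 2 * j) (contDiff_two_negLapPow (by omega : j < m) hw) x₀ r
    have e1 : k + 1 + 2 * (j + 1) = k + 2 * j + 3 := by ring
    have e2 : k + 2 * j + 1 = k + 1 + 2 * j := by ring
    have e3 : k + 2 * j + 2 = k + 1 + 1 + 2 * j := by ring
    rw [negLapPow_succ, wavg_neg, abs_neg, e1]
    have hmono := wavg_antitone (Nat.le_succ k)
      (hw.continuous) hpos x₀ r
    have h1 := hC x₀ r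
    have h1' := hC' x₀ r
    have hr : (0 : ℝ) ≤ r ^ (2 * j) := by rw [pow_mul]; positivity
    calc r ^ (2 * (j + 1)) * |wavg (k + 2 * j + 3) (lap (negLapPow j w)) x₀ r|
        = r ^ (2 * j) * |r ^ 2 * wavg (k + 2 * j + 3) (lap (negLapPow j w)) x₀ r| := by
          rw [abs_mul, abs_of_nonneg (sq_nonneg r)]; ring
      _ = r ^ (2 * j) * |a * wavg (k + 1 + 2 * j) (negLapPow j w) x₀ r
            - b * wavg (k + 1 + 1 + 2 * j) (negLapPow j w) x₀ r| := by
          rw [h2, e2, e3, ha, hb]; congr 2; ring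
      _ ≤ r ^ (2 * j) * (a * |wavg (k + 1 + 2 * j) (negLapPow j w) x₀ r|
            + b * |wavg (k + 1 + 1 + 2 * j) (negLapPow j w) x₀ r|) := by
          gcongr
          refine (abs_sub _ _).trans_eq ?_
          rw [abs_mul a, abs_mul b, abs_of_nonneg ha0, abs_of_nonneg hb0]
      _ = a * (r ^ (2 * j) * |wavg (k + 1 + 2 * j) (negLapPow j w) x₀ r|)
            + b * (r ^ (2 * j) * |wavg (k + 1 + 1 + 2 * j) (negLapPow j w) x₀ r|) := by ring
      _ ≤ a * (C * wavg (k + 1) w x₀ r) + b * (C' * wavg (k + 1) w x₀ r) := by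
          exact add_le_add (mul_le_mul_of_nonneg_left h1 ha0) (mul_le_mul_of_nonneg_left
            (h1'.trans (mul_le_mul_of_nonneg_left hmono hC0')) hb0)
      _ = _ := by ring

lemma tendsto_atBot_of_hasDerivAt {f g : ℝ → ℝ} {c δ : ℝ} (hc : 0 < c) (hδ : 0 < δ)
    (hf : ∀ r, HasDerivAt f (-(c * r * g r)) r) (hg : ∀ᶠ r in atTop, δ ≤ g r) :
    Tendsto f atTop atBot := by
  obtain ⟨r₀, hr₀⟩ := (hg.and (eventually_ge_atTop 0)).exists_forall_of_atTop
  have hd : ∀ r, HasDerivAt (fun r => f r + c * δ / 2 * r ^ 2) (-(c * r * g r) + c * δ * r) r := by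
    intro r
    refine (hf r).add ?_
    convert! (hasDerivAt_pow 2 r).const_mul (c * δ / 2) using 1
    push_cast
    ring
  have hanti : AntitoneOn (fun r => f r + c * δ / 2 * r ^ 2) (Set.Ici r₀) := by
    refine antitoneOn_of_deriv_nonpos (convex_Ici r₀)
      (fun r _ => (hd r).continuousAt.continuousWithinAt)
      (fun r _ => (hd r).differentiableAt.differentiableWithinAt) fun r hr => ?_
    rw [interior_Ici] at hr
    obtain ⟨h1, h2⟩ := hr₀ r (le_of_lt hr)
    rw [(hd r).deriv]
    have := mul_le_mul_of_nonneg_left h1 (mul_nonneg hc.le h2)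
    linarith
  have hlim : Tendsto (fun r : ℝ => (f r₀ + c * δ / 2 * r₀ ^ 2) - c * δ / 2 * r ^ 2)
      atTop atBot := by
    refine tendsto_atBot_add_const_left _ _ (tendsto_neg_atTop_atBot.comp ?_)
    exact (tendsto_pow_atTop two_ne_zero).const_mul_atTop (by positivity)
  refine tendsto_atBot_mono' _ ?_ hlim
  filter_upwards [eventually_ge_atTop r₀] with r hr
  have := hanti (Set.self_mem_Ici) hr hr
  simp only at this
  linarith

lemma tendsto_atTop_of_hasDerivAt {f g : ℝ → ℝ} {c δ : ℝ} (hc : 0 < c) (hδ : 0 < δ)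
    (hf : ∀ r, HasDerivAt f (-(c * r * g r)) r) (hg : ∀ᶠ r in atTop, g r ≤ -δ) :
    Tendsto f atTop atTop := by
  have := tendsto_atBot_of_hasDerivAt (f := fun r => -f r) (g := fun r => -g r) hc hδ
    (fun r => by convert! (hf r).neg using 1; ring)
    (hg.mono fun r h => by linarith)
  simpa [Function.comp_def] using tendsto_neg_atBot_atTop.comp this

lemma tendsto_abs_of_derivative_chain {B : ℕ → ℝ → ℝ} {c : ℕ → ℝ} (hc : ∀ j, 0 < c j) {δ : ℝ}
    (hδ : 0 < δ) (i : ℕ)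
    (hB : ∀ j, j < i + 1 → ∀ r, HasDerivAt (B j) (-(c j * r * B (j + 1) r)) r)
    (h : (∀ᶠ r in atTop, δ ≤ B (i + 1) r) ∨ ∀ᶠ r in atTop, B (i + 1) r ≤ -δ) :
    Tendsto (fun r => |B 0 r|) atTop atTop := by
  have step : Tendsto (B i) atTop atBot ∨ Tendsto (B i) atTop atTop :=
    h.imp (tendsto_atBot_of_hasDerivAt (hc i) hδ (hB i i.lt_succ_self))
      (tendsto_atTop_of_hasDerivAt (hc i) hδ (hB i i.lt_succ_self))
  induction i generalizing δ with
  | zero =>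
    exact step.elim tendsto_abs_atBot_atTop.comp tendsto_abs_atTop_atTop.comp
  | succ i ih =>
    have h' : (∀ᶠ r in atTop, 1 ≤ B (i + 1) r) ∨ ∀ᶠ r in atTop, B (i + 1) r ≤ -1 :=
      step.symm.imp (fun h => h.eventually_ge_atTop 1) fun h => h.eventually_le_atBot (-1)
    refine ih one_pos (fun j hj => hB j (by omega)) h' ?_
    exact h'.imp (tendsto_atBot_of_hasDerivAt (hc i) one_pos (hB i (by omega)))
      (tendsto_atTop_of_hasDerivAt (hc i) one_pos (hB i (by omega)))

lemma integral_bumpPow_pos (k : ℕ) :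
    0 < ∫ z : EuclideanSpace ℝ (Fin N), bumpPow (k + 1) z := by
  refine (continuous_bumpPow _).integral_pos_of_hasCompactSupport_nonneg_nonzero
    (hasCompactSupport_bumpPow k) (bumpPow_nonneg _) (x := 0) ?_
  simp [bumpPow]

lemma negLapPow_nonneg_of_succ_nonneg (k i m : ℕ) (him : i + 1 < m)
    {w : EuclideanSpace ℝ (Fin N) → ℝ} (hw : ContDiff ℝ (2 * (m : WithTop ℕ∞)) w)
    (hbdd : ∀ x₀, ∃ M, ∀ᶠ r in atTop, |wavg (k + 1) w x₀ r| ≤ M)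
    (hsucc : ∀ x, 0 ≤ negLapPow (i + 2) w x) (x₀ : EuclideanSpace ℝ (Fin N)) :
    0 ≤ negLapPow (i + 1) w x₀ := by
  by_contra! hneg
  set B : ℕ → ℝ → ℝ := fun j => wavg (k + j + 1) (negLapPow j w) x₀ with hBdef
  set c : ℕ → ℝ := fun j => 1 / (2 * ((k + j : ℕ) + 2)) with hcdef
  have hc : ∀ j, 0 < c j := fun j => by positivity
  have hB : ∀ j, j < m → ∀ r, HasDerivAt (B j) (-(c j * r * B (j + 1) r)) r := by
    intro j hj r
    convert! hasDerivAt_wavg (k + j) (contDiff_two_negLapPow hj hw) x₀ r using 1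
    simp only [hBdef, hcdef, negLapPow_succ, wavg_neg]
    rw [show k + (j + 1) + 1 = k + j + 2 by ring]
    ring
  have hI := integral_bumpPow_pos (N := N) (k + (i + 1))
  have h0 : B (i + 1) 0 = negLapPow (i + 1) w x₀ *
      ∫ z : EuclideanSpace ℝ (Fin N), bumpPow (k + (i + 1) + 1) z := by
    simp [hBdef, wavg, integral_const_mul]
  have hanti : AntitoneOn (B (i + 1)) (Set.Ici 0) := by
    refine antitoneOn_of_deriv_nonpos (convex_Ici 0)
      (fun r _ => (hB (i + 1) him r).continuousAt.continuousWithinAt)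
      (fun r _ => (hB (i + 1) him r).differentiableAt.differentiableWithinAt) fun r hr => ?_
    rw [interior_Ici] at hr
    rw [(hB (i + 1) him r).deriv, neg_nonpos]
    exact mul_nonneg (mul_nonneg (hc _).le (le_of_lt hr)) (wavg_nonneg _ hsucc x₀ r)
  have hlt : B (i + 1) 0 < 0 := h0 ▸ mul_neg_of_neg_of_pos hneg hI
  have hlim := tendsto_abs_of_derivative_chain hc (neg_pos.2 hlt) i (fun j hj => hB j (by omega))
    (Or.inr (by
      filter_upwards [eventually_ge_atTop 0] with r hr
      simpa using hanti Set.self_mem_Ici hr hr))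
  obtain ⟨M, hM⟩ := hbdd x₀
  obtain ⟨r, h1, h2⟩ := (hM.and (hlim.eventually_gt_atTop M)).exists
  exact absurd h1 (not_le.2 h2)

end Growth

section Kernel

variable {N : ℕ}

lemma CondK.integrable_mul {Φ : ℝ → ℝ} (hK : CondK N Φ) {a : EuclideanSpace ℝ (Fin N) → ℝ}
    (ha : Continuous a) (hpos : ∀ x, 0 ≤ a x)
    (hint : IntegrableOn (fun y => a y * Φ (‖y‖ / 2)) {y | 1 < ‖y‖})
    (x : EuclideanSpace ℝ (Fin N)) : Integrable fun y => a y * Φ ‖y - x‖ := by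
  have hloc : LocallyIntegrable fun y : EuclideanSpace ℝ (Fin N) => Φ ‖y - x‖ := by
    rw [locallyIntegrable_iff]
    intro K hKc
    have hK' : IsCompact ((fun y => y - x) '' K) := hKc.image (by fun_prop)
    have := hK.locInt.integrableOn_isCompact hK'
    have hmp := measurePreserving_sub_right (volume : Measure (EuclideanSpace ℝ (Fin N))) x
    have he : MeasurableEmbedding fun y : EuclideanSpace ℝ (Fin N) => y - x :=
      (Homeomorph.subRight x).measurableEmbedding
    exact (hmp.integrableOn_image he).1 this
  set R : ℝ := 2 * ‖x‖ + 1 with hR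
  have hball : IntegrableOn (fun y => a y * Φ ‖y - x‖) (closedBall 0 R) :=
    (hloc.integrableOn_isCompact (isCompact_closedBall 0 R)).continuousOn_mul ha.continuousOn
      (isCompact_closedBall 0 R)
  have hmeas : AEStronglyMeasurable (fun y => a y * Φ ‖y - x‖) :=
    ha.aestronglyMeasurable.mul hloc.aestronglyMeasurable
  have hcompl : IntegrableOn (fun y => a y * Φ ‖y - x‖) (closedBall 0 R)ᶜ := by
    have hsub : (closedBall (0 : EuclideanSpace ℝ (Fin N)) R)ᶜ ⊆ {y | 1 < ‖y‖} := by
      intro y hy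
      simp only [Set.mem_compl_iff, mem_closedBall, dist_zero_right, not_le] at hy
      have := norm_nonneg x
      simp only [Set.mem_ofPred_eq]
      linarith
    refine (hint.mono_set hsub).mono' hmeas.restrict ?_
    refine (ae_restrict_iff' isClosed_closedBall.measurableSet.compl).2
      (Eventually.of_forall fun y hy => ?_)
    simp only [Set.mem_compl_iff, mem_closedBall, dist_zero_right, not_le] at hy
    have h1 := norm_sub_norm_le y x
    have h2 := norm_nonneg x
    have h3 : 0 < ‖y‖ / 2 := by linarith
    have h4 : ‖y‖ / 2 ≤ ‖y - x‖ := by linarith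
    rw [Real.norm_of_nonneg (mul_nonneg (hpos y) (hK.pos _ (h3.trans_le h4)).le)]
    exact mul_le_mul_of_nonneg_left (hK.anti h3 (h3.trans_le h4) h4) (hpos y)
  simpa using hball.union hcompl

lemma pow_mul_wavg (k : ℕ) (a : EuclideanSpace ℝ (Fin N) → ℝ) (x₀ : EuclideanSpace ℝ (Fin N))
    {r : ℝ} (hr : 0 < r) :
    r ^ N * wavg k a x₀ r = ∫ y, a y * bumpPow k (r⁻¹ • (y - x₀)) := by
  have h1 := Measure.integral_comp_smul_of_nonneg
    (volume : Measure (EuclideanSpace ℝ (Fin N)))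
    (fun y => a (x₀ + y) * bumpPow k (r⁻¹ • y)) r (hR := hr.le)
  have h2 := integral_sub_right_eq_self (μ := (volume : Measure (EuclideanSpace ℝ (Fin N))))
    (fun y => a (x₀ + y) * bumpPow k (r⁻¹ • y)) x₀
  simp only [smul_smul, inv_mul_cancel₀ hr.ne', one_smul, finrank_euclideanSpace,
    Fintype.card_fin] at h1
  simp only [add_sub_cancel] at h2
  rw [wavg, h1, h2, smul_eq_mul, mul_inv_cancel_left₀ (pow_pos hr N).ne']

lemma CondK.mul_wavg_le_integral (hN : 1 ≤ N) {Φ : ℝ → ℝ} (hK : CondK N Φ) (k : ℕ)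
    {a : EuclideanSpace ℝ (Fin N) → ℝ} (ha : Continuous a) (hpos : ∀ x, 0 ≤ a x)
    (hint : IntegrableOn (fun y => a y * Φ (‖y‖ / 2)) {y | 1 < ‖y‖})
    {x₀ x : EuclideanSpace ℝ (Fin N)} {r : ℝ} (hr : 0 < r) (hx : dist x x₀ ≤ r) :
    r ^ N * Φ (2 * r) * wavg (k + 1) a x₀ r ≤ ∫ y, a y * Φ ‖y - x‖ := by
  have : Nonempty (Fin N) := ⟨⟨0, hN⟩⟩
  rw [mul_right_comm, pow_mul_wavg _ _ _ hr, ← integral_mul_const]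
  refine integral_mono_ae ?_ (hK.integrable_mul ha hpos hint x) ?_
  · refine Integrable.mul_const (Continuous.integrable_of_hasCompactSupport ?_ ?_) _
    · have := continuous_bumpPow (N := N) (k + 1)
      fun_prop
    · refine HasCompactSupport.mul_left ?_
      have := (hasCompactSupport_bumpPow (N := N) k).comp_homeomorph
        ((Homeomorph.subRight x₀).trans (Homeomorph.smulOfNeZero r⁻¹ (inv_pos.2 hr).ne'))
      exact this
  · have hne : ∀ᵐ y : EuclideanSpace ℝ (Fin N), y ≠ x := by
      simp [ae_iff]
    filter_upwards [hne] with y hy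
    have hyx : 0 < ‖y - x‖ := norm_pos_iff.2 (sub_ne_zero.2 hy)
    rw [mul_assoc]
    refine mul_le_mul_of_nonneg_left ?_ (hpos y)
    rcases le_total 1 ‖r⁻¹ • (y - x₀)‖ with h | h
    · rw [bumpPow_eq_zero k h, zero_mul]
      exact (hK.pos _ hyx).le
    · have h1 : ‖y - x₀‖ ≤ r := by
        rw [norm_smul, Real.norm_of_nonneg (inv_pos.2 hr).le, inv_mul_le_iff₀ hr] at h
        linarith
      have h2 : ‖y - x‖ ≤ 2 * r := by
        rw [← dist_eq_norm] at h1 ⊢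
        linarith [dist_triangle_right y x x₀]
      have h3 := hK.pos (2 * r) (by linarith)
      calc bumpPow (k + 1) (r⁻¹ • (y - x₀)) * Φ (2 * r) ≤ 1 * Φ (2 * r) := by
            gcongr; exact bumpPow_le_one _ _
        _ ≤ Φ ‖y - x‖ := by
            rw [one_mul]
            exact hK.anti hyx (by simpa using hr) h2

lemma CondK.eventually_one_le {Φ : ℝ → ℝ} (hK : CondK N Φ) :
    ∀ᶠ r in atTop, 1 ≤ r ^ N * Φ (2 * r) := by
  have h : Tendsto (fun r : ℝ => 2 * r) atTop atTop := tendsto_id.const_mul_atTop two_pos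
  filter_upwards [(hK.tendsto.comp h).eventually_ge_atTop (2 ^ N)] with r hr
  simp only [Function.comp, mul_pow, mul_assoc] at hr
  exact le_of_mul_le_mul_left (by simpa using hr) (by positivity : (0 : ℝ) < 2 ^ N)

lemma sq_integral_le_mul_integral {α : Type*} [MeasurableSpace α] {μ : Measure α} {f g h : α → ℝ}
    (hf : Integrable f μ) (hg : Integrable g μ) (hh : Integrable h μ) (hf0 : ∀ x, 0 ≤ f x)
    (hg0 : ∀ x, 0 ≤ g x) (hle : ∀ x, h x ^ 2 ≤ f x * g x) :
    (∫ x, h x ∂μ) ^ 2 ≤ (∫ x, f x ∂μ) * ∫ x, g x ∂μ := by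
  have key : ∀ t : ℝ, 0 ≤ (∫ x, f x ∂μ) * (t * t) + (2 * ∫ x, h x ∂μ) * t + ∫ x, g x ∂μ := by
    intro t
    have : ∫ x, (f x * (t * t) + h x * (2 * t) + g x) ∂μ =
        (∫ x, f x ∂μ) * (t * t) + (2 * ∫ x, h x ∂μ) * t + ∫ x, g x ∂μ := by
      have h1 : Integrable (fun x => f x * (t * t) + h x * (2 * t)) μ :=
        (hf.mul_const _).add (hh.mul_const _)
      rw [integral_add h1 hg, integral_add (hf.mul_const _) (hh.mul_const _), integral_mul_const,
        integral_mul_const]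
      ring
    rw [← this]
    refine integral_nonneg fun x => ?_
    have h1 : |h x| ≤ √(f x) * √(g x) := by
      rw [← Real.sqrt_mul (hf0 x)]
      exact Real.abs_le_sqrt (hle x)
    have h2 : -(|t| * (√(f x) * √(g x))) ≤ h x * t := by
      have := mul_le_mul_of_nonneg_left h1 (abs_nonneg t)
      have h3 := neg_abs_le (h x * t)
      rw [abs_mul] at h3
      linarith
    have h3 := sq_nonneg (|t| * √(f x) - √(g x))
    have h4 := Real.sq_sqrt (hf0 x)
    have h5 := Real.sq_sqrt (hg0 x)
    have h6 := sq_abs t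
    have h7 : (|t| * √(f x) - √(g x)) ^ 2 =
      f x * (t * t) - 2 * (|t| * (√(f x) * √(g x))) + g x := by
      calc _ = |t| ^ 2 * √(f x) ^ 2 - 2 * (|t| * (√(f x) * √(g x))) + √(g x) ^ 2 := by ring
        _ = _ := by rw [h4, h5, h6]; ring
    simp only [Pi.zero_apply]
    linarith
  have := discrim_le_zero key
  simp only [discrim] at this
  linarith

lemma wavg_one (k : ℕ) (x₀ : EuclideanSpace ℝ (Fin N)) (r : ℝ) :
    wavg k (fun _ => 1) x₀ r = ∫ z : EuclideanSpace ℝ (Fin N), bumpPow k z := by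
  simp [wavg]

lemma le_one_add_rpow {t s : ℝ} (ht : 0 ≤ t) (hs : 1 ≤ s) : t ≤ 1 + t ^ s := by
  rcases le_total t 1 with h | h
  · linarith [Real.rpow_nonneg ht s]
  · linarith [Real.self_le_rpow_of_one_le h hs]

lemma wavg_le_add_wavg_rpow (k : ℕ) {w : EuclideanSpace ℝ (Fin N) → ℝ} (hw : Continuous w)
    (hpos : ∀ x, 0 ≤ w x) {s : ℝ} (hs : 1 ≤ s) (x₀ : EuclideanSpace ℝ (Fin N)) (r : ℝ) :
    wavg (k + 1) w x₀ r ≤ (∫ z : EuclideanSpace ℝ (Fin N), bumpPow (k + 1) z) +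
      wavg (k + 1) (fun x => w x ^ s) x₀ r := by
  have hc : Continuous fun x => w x ^ s :=
    hw.rpow_const fun x => Or.inr (by linarith)
  refine (wavg_mono k (w' := fun x => 1 + w x ^ s) hw (continuous_const.add hc)
    (fun x => le_one_add_rpow (hpos x) hs) x₀ r).trans_eq ?_
  rw [← wavg_one (k + 1) x₀ r]
  simp only [wavg, add_mul]
  exact integral_add (integrable_wavg k (continuous_const (y := (1 : ℝ))) x₀ r) (integrable_wavg k hc x₀ r)

lemma CondK.exists_bound_wavg (hN : 1 ≤ N) {Φ : ℝ → ℝ} (hK : CondK N Φ) (k : ℕ)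
    {w : EuclideanSpace ℝ (Fin N) → ℝ} (hw : Continuous w) (hpos : ∀ x, 0 ≤ w x) {p : ℝ}
    (hp : 1 ≤ p) (hint : IntegrableOn (fun y => w y ^ p * Φ (‖y‖ / 2)) {y | 1 < ‖y‖})
    (x₀ : EuclideanSpace ℝ (Fin N)) : ∃ M, ∀ᶠ r in atTop, |wavg (k + 1) w x₀ r| ≤ M := by
  refine ⟨(∫ z : EuclideanSpace ℝ (Fin N), bumpPow (k + 1) z) + ∫ y, w y ^ p * Φ ‖y - x₀‖, ?_⟩
  filter_upwards [hK.eventually_one_le, eventually_gt_atTop 0] with r hr hr0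
  rw [abs_of_nonneg (wavg_nonneg _ hpos x₀ r)]
  refine (wavg_le_add_wavg_rpow k hw hpos hp x₀ r).trans ?_
  refine add_le_add_right ?_ _
  have h0 : ∀ x, 0 ≤ w x ^ p := fun x => Real.rpow_nonneg (hpos x) p
  refine le_trans ?_ (hK.mul_wavg_le_integral hN k
    (hw.rpow_const fun x => Or.inr (by linarith)) h0 hint (x₀ := x₀) hr0 (by simpa using hr0.le))
  exact le_mul_of_one_le_left (wavg_nonneg _ h0 x₀ r) hr

lemma CondK.exists_sq_wavg_le (hN : 1 ≤ N) {Φ : ℝ → ℝ} (hK : CondK N Φ) {m : ℕ} {p q : ℝ}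
    (hp : 0 < p) (hq : 0 < q) (hpq : 2 ≤ p + q) {u v : EuclideanSpace ℝ (Fin N) → ℝ}
    (hu : ContDiff ℝ (2 * (m : WithTop ℕ∞)) u) (hv : Continuous v) (hupos : ∀ x, 0 ≤ u x)
    (hvpos : ∀ x, 0 ≤ v x)
    (hint : IntegrableOn (fun y => v y ^ p * Φ (‖y‖ / 2)) {y | 1 < ‖y‖})
    (hineq : ∀ x, (∫ y, v y ^ p * Φ ‖y - x‖) * v x ^ q ≤ negLapPow m u x) :
    ∃ C, 0 ≤ C ∧ ∀ x₀, ∀ᶠ r in atTop,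
      (∫ z : EuclideanSpace ℝ (Fin N), bumpPow (2 * m + 1 + 1) z) ≤ wavg (2 * m + 1 + 1) v x₀ r →
      (wavg (2 * m + 1 + 1) v x₀ r - ∫ z : EuclideanSpace ℝ (Fin N), bumpPow (2 * m + 1 + 1) z) ^ 2
        ≤ C * wavg (2 * m + 1 + 1) u x₀ r := by
  obtain ⟨C, hC0, hC⟩ := exists_pow_mul_abs_wavg_negLapPow_le hu hupos m le_rfl (2 * m + 1)
  refine ⟨C, hC0, fun x₀ => ?_⟩
  filter_upwards [hK.eventually_one_le, eventually_ge_atTop 1] with r hr hr1 hge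
  have hr0 : 0 < r := by linarith
  have cp : Continuous fun x => v x ^ p := hv.rpow_const fun x => Or.inr hp.le
  have cq : Continuous fun x => v x ^ q := hv.rpow_const fun x => Or.inr hq.le
  have cs : Continuous fun x => v x ^ ((p + q) / 2) :=
    hv.rpow_const fun x => Or.inr (by linarith)
  have hp0 : ∀ x, 0 ≤ v x ^ p := fun x => Real.rpow_nonneg (hvpos x) p
  have hq0 : ∀ x, 0 ≤ v x ^ q := fun x => Real.rpow_nonneg (hvpos x) q
  have h1 := wavg_le_add_wavg_rpow (2 * m + 1) hv hvpos (s := (p + q) / 2) (by linarith) x₀ r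
  have h2 : wavg (2 * m + 1 + 1) (fun x => v x ^ ((p + q) / 2)) x₀ r ^ 2 ≤
      wavg (1 + 1) (fun x => v x ^ p) x₀ r * wavg (4 * m + 1 + 1) (fun x => v x ^ q) x₀ r := by
    refine sq_integral_le_mul_integral (integrable_wavg _ cp x₀ r) (integrable_wavg _ cq x₀ r)
      (integrable_wavg _ cs x₀ r) (fun z => mul_nonneg (hp0 _) (bumpPow_nonneg _ _))
      (fun z => mul_nonneg (hq0 _) (bumpPow_nonneg _ _)) fun z => le_of_eq ?_
    have e1 : (v (x₀ + r • z) ^ ((p + q) / 2)) ^ 2 = v (x₀ + r • z) ^ p * v (x₀ + r • z) ^ q := by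
      rw [← Real.rpow_natCast, ← Real.rpow_mul (hvpos _), ← Real.rpow_add_of_nonneg (hvpos _) hp.le
        hq.le]
      congr 1
      push_cast
      ring
    rw [mul_pow, e1]
    simp only [bumpPow]
    ring
  have h3 : wavg (1 + 1) (fun x => v x ^ p) x₀ r * wavg (4 * m + 1 + 1) (fun x => v x ^ q) x₀ r ≤
      wavg (4 * m + 1 + 1) (negLapPow m u) x₀ r := by
    rw [wavg, wavg, ← integral_const_mul]
    refine integral_mono ((integrable_wavg _ cq x₀ r).const_mul _)
      (integrable_wavg _ (continuous_negLapPow hu) x₀ r) fun z => ?_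
    simp only
    rcases le_total 1 ‖z‖ with h | h
    · simp [bumpPow_eq_zero _ h]
    · rw [← mul_assoc]
      refine mul_le_mul_of_nonneg_right (le_trans ?_ (hineq _)) (bumpPow_nonneg _ _)
      refine mul_le_mul_of_nonneg_right ?_ (hq0 _)
      refine le_trans ?_ (hK.mul_wavg_le_integral hN 1 cp hp0 hint (x₀ := x₀) hr0 ?_)
      · exact le_mul_of_one_le_left (wavg_nonneg _ hp0 x₀ r) hr
      · rw [dist_self_add_left, norm_smul, Real.norm_of_nonneg hr0.le]
        exact mul_le_of_le_one_right hr0.le h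
  have h4 : wavg (4 * m + 1 + 1) (negLapPow m u) x₀ r ≤ C * wavg (2 * m + 1 + 1) u x₀ r := by
    refine le_trans ?_ (hC x₀ r)
    rw [show 2 * m + 1 + 1 + 2 * m = 4 * m + 1 + 1 by ring]
    exact (le_abs_self _).trans (le_mul_of_one_le_left (abs_nonneg _) (one_le_pow₀ hr1))
  calc _ ≤ wavg (2 * m + 1 + 1) (fun x => v x ^ ((p + q) / 2)) x₀ r ^ 2 := by
        gcongr
        linarith
    _ ≤ _ := h2.trans (h3.trans h4)

lemma le_of_cross_sq_le {X Y I C : ℝ} (hX : 0 ≤ X) (hI : 0 ≤ I) (hC : 0 ≤ C)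
    (hXY : I ≤ Y → (Y - I) ^ 2 ≤ C * X) (hYX : I ≤ X → (X - I) ^ 2 ≤ C * Y) :
    X ≤ 2 * I + 4 * C := by
  by_contra! h
  have h1 := hYX (by linarith)
  rcases le_total Y X with hle | hle
  · have h2 : (X / 2) ^ 2 ≤ (X - I) ^ 2 := by gcongr; linarith
    nlinarith [mul_le_mul_of_nonneg_left hle hC]
  · have h2 : (Y / 2) ^ 2 ≤ (Y - I) ^ 2 := by
      have : 0 ≤ Y / 2 := by linarith
      gcongr; linarith
    have h3 := hXY (by linarith)
    nlinarith [mul_le_mul_of_nonneg_left hle hC]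

lemma negLapPow_nonneg_of_bound (k m : ℕ) {w : EuclideanSpace ℝ (Fin N) → ℝ}
    (hw : ContDiff ℝ (2 * (m : WithTop ℕ∞)) w)
    (hbdd : ∀ x₀, ∃ M, ∀ᶠ r in atTop, |wavg (k + 1) w x₀ r| ≤ M)
    (hm : ∀ x, 0 ≤ negLapPow m w x) (i : ℕ) (hi : 1 ≤ i) (him : i ≤ m) :
    ∀ x, 0 ≤ negLapPow i w x := by
  induction him using Nat.decreasingInduction with
  | self => exact hm
  | of_succ i him ih =>
    obtain ⟨j, rfl⟩ := Nat.exists_eq_add_of_le' hi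
    exact negLapPow_nonneg_of_succ_nonneg k j m him hw hbdd (ih (by omega))

lemma CondK.integral_mul_nonneg (hN : 1 ≤ N) {Φ : ℝ → ℝ} (hK : CondK N Φ)
    {a : EuclideanSpace ℝ (Fin N) → ℝ} (hpos : ∀ x, 0 ≤ a x) (x : EuclideanSpace ℝ (Fin N)) :
    0 ≤ ∫ y, a y * Φ ‖y - x‖ := by
  have : Nonempty (Fin N) := ⟨⟨0, hN⟩⟩
  have hne : ∀ᵐ y : EuclideanSpace ℝ (Fin N), y ≠ x := by simp [ae_iff]
  refine integral_nonneg_of_ae ?_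
  filter_upwards [hne] with y hy
  exact mul_nonneg (hpos y) (hK.pos _ (norm_pos_iff.2 (sub_ne_zero.2 hy))).le

end Kernel

theorem stmt_17 (N m : ℕ) (hN : 1 ≤ N) (hm : 1 ≤ m)
    (Φ Ψ : ℝ → ℝ) (hKΦ : CondK N Φ) (hKΨ : CondK N Ψ)
    (p₁ q₁ p₂ q₂ : ℝ) (hp₁ : 0 < p₁) (hq₁ : 0 < q₁) (hp₂ : 0 < p₂) (hq₂ : 0 < q₂)
    (hcond : (2 ≤ p₁ + q₁ ∧ 2 ≤ p₂ + q₂) ∨ (1 ≤ p₁ ∧ 1 ≤ p₂))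
    (u v : EuclideanSpace ℝ (Fin N) → ℝ)
    (hureg : ContDiff ℝ (2 * m) u) (hvreg : ContDiff ℝ (2 * m) v)
    (hupos : ∀ x, 0 ≤ u x) (hvpos : ∀ x, 0 ≤ v x)
    (hintv : IntegrableOn (fun y : EuclideanSpace ℝ (Fin N) => v y ^ p₁ * Φ (‖y‖ / 2))
      {y : EuclideanSpace ℝ (Fin N) | 1 < ‖y‖})
    (hintu : IntegrableOn (fun y : EuclideanSpace ℝ (Fin N) => u y ^ p₂ * Ψ (‖y‖ / 2))
      {y : EuclideanSpace ℝ (Fin N) | 1 < ‖y‖})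
    (hinequ : ∀ x : EuclideanSpace ℝ (Fin N),
      (∫ y : EuclideanSpace ℝ (Fin N), v y ^ p₁ * Φ ‖y - x‖) * v x ^ q₁
        ≤ negLapPow m u x)
    (hineqv : ∀ x : EuclideanSpace ℝ (Fin N),
      (∫ y : EuclideanSpace ℝ (Fin N), u y ^ p₂ * Ψ ‖y - x‖) * u x ^ q₂
        ≤ negLapPow m v x) :
    ∀ i, 1 ≤ i → i ≤ m →
      (∀ x, 0 ≤ negLapPow i u x) ∧ (∀ x, 0 ≤ negLapPow i v x) := by
  have hum : ∀ x, 0 ≤ negLapPow m u x := fun x => (mul_nonneg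
    (hKΦ.integral_mul_nonneg hN (fun y => Real.rpow_nonneg (hvpos y) p₁) x)
    (Real.rpow_nonneg (hvpos x) q₁)).trans (hinequ x)
  have hvm : ∀ x, 0 ≤ negLapPow m v x := fun x => (mul_nonneg
    (hKΨ.integral_mul_nonneg hN (fun y => Real.rpow_nonneg (hupos y) p₂) x)
    (Real.rpow_nonneg (hupos x) q₂)).trans (hineqv x)
  have hbdd : (∀ x₀, ∃ M, ∀ᶠ r in atTop, |wavg (2 * m + 1 + 1) u x₀ r| ≤ M) ∧
      (∀ x₀, ∃ M, ∀ᶠ r in atTop, |wavg (2 * m + 1 + 1) v x₀ r| ≤ M) := by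
    rcases hcond with ⟨h₁, h₂⟩ | ⟨h₁, h₂⟩
    · obtain ⟨C₁, hC₁0, hC₁⟩ := hKΦ.exists_sq_wavg_le hN hp₁ hq₁ h₁ hureg hvreg.continuous
        hupos hvpos hintv hinequ
      obtain ⟨C₂, hC₂0, hC₂⟩ := hKΨ.exists_sq_wavg_le hN hp₂ hq₂ h₂ hvreg hureg.continuous
        hvpos hupos hintu hineqv
      have hI := (integral_bumpPow_pos (N := N) (2 * m + 1)).le
      have hX := wavg_nonneg (2 * m + 1 + 1) hupos
      have hY := wavg_nonneg (2 * m + 1 + 1) hvpos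
      have hC0 : 0 ≤ max C₁ C₂ := le_max_of_le_left hC₁0
      have hcross₁ := fun x₀ => (hC₁ x₀).mono fun r h hge =>
        (h hge).trans (mul_le_mul_of_nonneg_right (le_max_left C₁ C₂) (hX x₀ r))
      have hcross₂ := fun x₀ => (hC₂ x₀).mono fun r h hge =>
        (h hge).trans (mul_le_mul_of_nonneg_right (le_max_right C₁ C₂) (hY x₀ r))
      set I := ∫ z : EuclideanSpace ℝ (Fin N), bumpPow (2 * m + 1 + 1) z
      refine ⟨fun x₀ => ⟨2 * I + 4 * max C₁ C₂, ?_⟩, fun x₀ => ⟨2 * I + 4 * max C₁ C₂, ?_⟩⟩ <;>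
        filter_upwards [hcross₁ x₀, hcross₂ x₀] with r h₁ h₂
      · rw [abs_of_nonneg (hX x₀ r)]
        exact le_of_cross_sq_le (hX x₀ r) hI hC0 h₁ h₂
      · rw [abs_of_nonneg (hY x₀ r)]
        exact le_of_cross_sq_le (hY x₀ r) hI hC0 h₂ h₁
    · exact ⟨hKΨ.exists_bound_wavg hN _ hureg.continuous hupos h₂ hintu,
        hKΦ.exists_bound_wavg hN _ hvreg.continuous hvpos h₁ hintv⟩
  exact fun i hi him => ⟨negLapPow_nonneg_of_bound _ m hureg hbdd.1 hum i hi him,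
    negLapPow_nonneg_of_bound _ m hvreg hbdd.2 hvm i hi him⟩
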